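/- arXiv:1504.06467 — 2 statements merged into one kernel-verified Lean document; each statement's English description precedes it below -/
import Mathlib

section
/- Let p be a prime number and let M and N be finitely generated abelian groups whose torsion elements all have p-power order. Let φ : M → N be an injective group homomorphism such that N/φ(M) is torsion with no element of order p, and let q : ℤ^r → M be a surjective group homomorphism. Then there exist an injective group homomorphism α : ℤ^r → ℤ^r and a surjective group homomorphism q' : ℤ^r → N such that q' ∘ α = φ ∘ q. -/
/-- In an additive group without elements of order `p`, only `0` has `p`-power order. -/
theorem eq_zero_of_prime_pow_nsmul_eq_zero {G : Type*} [AddCommGroup G] {p : ℕ}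
    (hp : p.Prime) (hG : ∀ z : G, addOrderOf z ≠ p) :
    ∀ (k : ℕ) (z : G), p ^ k • z = 0 → z = 0 := by
  intro k
  induction k with
  | zero => intro z hz; simpa using hz
  | succ k ih =>
    intro z hz
    apply ih
    by_contra hne
    refine hG (p ^ k • z) ?_
    have : Fact p.Prime := ⟨hp⟩
    refine addOrderOf_eq_prime ?_ hne
    rw [← mul_nsmul, ← pow_succ, hz]

/-- Torsion elements of `N` have `p`-power order and `N ⧸ A` has no element of order `p`,
so `A` contains the torsion of `N`. -/
theorem torsion_le_of_quotient_addOrderOf_ne {N : Type*} [AddCommGroup N] {p : ℕ}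
    (hp : p.Prime) (hNp : ∀ y : N, IsOfFinAddOrder y → ∃ k : ℕ, addOrderOf y = p ^ k)
    (A : AddSubgroup N) (hA : ∀ z : N ⧸ A, addOrderOf z ≠ p)
    {y : N} (hy : y ∈ Submodule.torsion ℤ N) : y ∈ A := by
  obtain ⟨⟨a, ha⟩, hay⟩ := hy
  have hfin : IsOfFinAddOrder y :=
    isOfFinAddOrder_iff_zsmul_eq_zero.2 ⟨a, nonZeroDivisors.ne_zero ha, hay⟩
  obtain ⟨k, hk⟩ := hNp y hfin
  rw [← QuotientAddGroup.eq_zero_iff]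
  refine eq_zero_of_prime_pow_nsmul_eq_zero hp hA k _ ?_
  rw [← QuotientAddGroup.mk_nsmul, ← hk, addOrderOf_nsmul_eq_zero, QuotientAddGroup.mk_zero]

/-- A linear map `f : P → N` over `ℤ`, from a finite free module to a finite one, whose range
contains the torsion of `N` and has torsion cokernel, factors as an injective endomorphism
of `P` followed by a surjection `P → N`. -/
theorem LinearMap.exists_injective_surjective_comp_eq
    {P N : Type*} [AddCommGroup P] [AddCommGroup N] [Module.Finite ℤ P] [Module.Free ℤ P]
    [Module.Finite ℤ N] (f : P →ₗ[ℤ] N)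
    (htors : Submodule.torsion ℤ N ≤ LinearMap.range f)
    (hcoker : ∀ y : N, ∃ n : ℤ, n ≠ 0 ∧ n • y ∈ LinearMap.range f) :
    ∃ (α : P →ₗ[ℤ] P) (g : P →ₗ[ℤ] N),
      Function.Injective α ∧ Function.Surjective g ∧ g ∘ₗ α = f := by
  let π := (Submodule.torsion ℤ N).mkQ
  let ψ := π ∘ₗ f
  have : Module.Free ℤ (N ⧸ Submodule.torsion ℤ N) := Module.free_of_finite_type_torsion_free'
  obtain ⟨g, hg⟩ := Module.projective_lifting_property π LinearMap.id
    (Submodule.mkQ_surjective _)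
  have hπg : ∀ l, π (g l) = l := fun l => LinearMap.congr_fun hg l
  have hker : ∀ {y : N}, π y = 0 → y ∈ LinearMap.range f := fun {y} hy =>
    htors ((Submodule.Quotient.mk_eq_zero _).1 hy)
  have hmem : ∀ l : LinearMap.range ψ, g l ∈ LinearMap.range f := by
    rintro ⟨_, x, rfl⟩
    have h := hker (y := g (ψ x) - f x) (by rw [map_sub, hπg]; exact sub_self _)
    simpa using add_mem h (LinearMap.mem_range_self f x)
  obtain ⟨s, hs⟩ := Module.projective_lifting_property f.rangeRestrict
    ((g ∘ₗ (LinearMap.range ψ).subtype).codRestrict (LinearMap.range f) hmem)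
    f.surjective_rangeRestrict
  have hfs : ∀ l, f (s l) = g l := fun l => congrArg Subtype.val (LinearMap.congr_fun hs l)
  have hψs : ∀ l, ψ (s l) = l := fun l => by
    change π (f (s l)) = _
    rw [hfs, hπg]
  let k : P →ₗ[ℤ] LinearMap.ker ψ :=
    (LinearMap.id - s ∘ₗ ψ.rangeRestrict).codRestrict _ fun x => by
      simp [hψs]
  have hrank : Module.finrank ℤ ((N ⧸ Submodule.torsion ℤ N) × LinearMap.ker ψ) =
      Module.finrank ℤ P := by
    have htor : Module.finrank ℤ ((N ⧸ Submodule.torsion ℤ N) ⧸ LinearMap.range ψ) = 0 := by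
      rw [Module.finrank_eq_zero_iff]
      intro z
      obtain ⟨l, rfl⟩ := Submodule.mkQ_surjective _ z
      obtain ⟨y, rfl⟩ := Submodule.mkQ_surjective _ l
      obtain ⟨n, hn, x, hx⟩ := hcoker y
      refine ⟨n, hn, ?_⟩
      rw [← map_smul, ← map_smul, ← hx]
      exact (Submodule.Quotient.mk_eq_zero _).2 ⟨x, rfl⟩
    have h₁ := (LinearMap.range ψ).finrank_quotient_add_finrank
    have h₂ := (LinearMap.ker ψ).finrank_quotient_add_finrank
    have h₃ := ψ.quotKerEquivRange.finrank_eq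
    rw [Module.finrank_prod]
    omega
  let e := LinearEquiv.ofFinrankEq _ _ hrank
  let G := g.coprod (f ∘ₗ (LinearMap.ker ψ).subtype)
  refine ⟨e.toLinearMap ∘ₗ ψ.prod k, G ∘ₗ e.symm.toLinearMap, ?_, ?_, ?_⟩
  · refine e.injective.comp ((injective_iff_map_eq_zero _).2 fun x hx => ?_)
    have hψ : ψ x = 0 := congrArg Prod.fst hx
    have hk : x - s (ψ.rangeRestrict x) = 0 :=
      congrArg (fun v => (v.2 : P)) hx
    have hψ' : ψ.rangeRestrict x = 0 := Subtype.ext hψ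
    simpa [hψ'] using hk
  · suffices hG : Function.Surjective G from hG.comp e.symm.surjective
    intro y
    have h0 : π (y - g (π y)) = 0 := by rw [map_sub, hπg, sub_self]
    obtain ⟨x, hx⟩ := hker h0
    refine ⟨(π y, ⟨x, ?_⟩), ?_⟩
    · change π (f x) = 0
      rw [hx, h0]
    · change g (π y) + f x = y
      rw [hx, add_sub_cancel]
  · refine LinearMap.ext fun x => ?_
    change G (e.symm (e (ψ.prod k x))) = f x
    rw [e.symm_apply_apply]
    change g (ψ x) + f (x - s (ψ.rangeRestrict x)) = f x
    rw [map_sub, hfs]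
    exact add_sub_cancel _ _

/-- Splitting claim inside the proof of Theorem 2.6 of the paper.
Let `p` be a prime and `M`, `N` finitely generated abelian groups all of whose torsion
elements have `p`-power order. Let `φ : M → N` be an injective homomorphism such that
`N/φ(M)` is torsion with no element of order `p`, and let `q : ℤ^r → M` be a surjective
homomorphism. Then there exist an injective homomorphism `α : ℤ^r → ℤ^r` and a
surjective homomorphism `q' : ℤ^r → N` with `q' ∘ α = φ ∘ q`. -/
theorem exists_reparameterization_splitting
    (p : ℕ) (hp : p.Prime) (r : ℕ)
    {M N : Type*} [AddCommGroup M] [AddCommGroup N]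
    (hMfg : AddGroup.FG M) (hNfg : AddGroup.FG N)
    (hMp : ∀ x : M, IsOfFinAddOrder x → ∃ k : ℕ, addOrderOf x = p ^ k)
    (hNp : ∀ y : N, IsOfFinAddOrder y → ∃ k : ℕ, addOrderOf y = p ^ k)
    (φ : M →+ N) (hinj : Function.Injective φ)
    (htor : ∀ z : N ⧸ φ.range, IsOfFinAddOrder z)
    (hnop : ∀ z : N ⧸ φ.range, addOrderOf z ≠ p)
    (q : (Fin r → ℤ) →+ M) (hq : Function.Surjective q) :
    ∃ (α : (Fin r → ℤ) →+ (Fin r → ℤ)) (q' : (Fin r → ℤ) →+ N),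
      Function.Injective α ∧ Function.Surjective q' ∧ q'.comp α = φ.comp q := by
  have : Module.Finite ℤ N := Module.Finite.iff_addGroup_fg.2 hNfg
  let f : (Fin r → ℤ) →ₗ[ℤ] N := (φ.comp q).toIntLinearMap
  have hf : ∀ y : N, y ∈ φ.range → y ∈ LinearMap.range f := by
    rintro _ ⟨m, rfl⟩
    obtain ⟨x, rfl⟩ := hq m
    exact ⟨x, rfl⟩
  obtain ⟨α, q', hα, hq', h⟩ := f.exists_injective_surjective_comp_eq
    (fun y hy => hf y (torsion_le_of_quotient_addOrderOf_ne hp hNp φ.range hnop hy))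
    (fun y => by
      obtain ⟨n, hn, hny⟩ := isOfFinAddOrder_iff_zsmul_eq_zero.1 (htor y)
      refine ⟨n, hn, hf _ ?_⟩
      rwa [← QuotientAddGroup.mk_zsmul, QuotientAddGroup.eq_zero_iff] at hny)
  exact ⟨α.toAddMonoidHom, q'.toAddMonoidHom, hα, hq',
    AddMonoidHom.ext fun x => LinearMap.congr_fun h x⟩
end

section
/- Let f : A → B be a surjective homomorphism of commutative noetherian local rings, with maximal ideals 𝔪_A and 𝔪_B (so 𝔪_B = f(𝔪_A)B and f induces an isomorphism of residue fields k = A/𝔪_A ≅ B/𝔪_B). Suppose that for every n ≥ 0 the k-vector spaces 𝔪_Aⁿ/𝔪_Aⁿ⁺¹ and 𝔪_Bⁿ/𝔪_Bⁿ⁺¹ (the latter regarded as a k-vector space via f) have the same finite dimension. Then f is injective, hence an isomorphism. -/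
open IsLocalRing

/-- The `n`-th graded piece `𝔪ⁿ/𝔪ⁿ⁺¹` of the `𝔪`-adic associated graded ring of a local
ring `(R, 𝔪)`, realized as `𝔪ⁿ/(𝔪·𝔪ⁿ)`; it is a vector space over the residue field
`R/𝔪`. -/
abbrev GradedPiece (R : Type*) [CommRing R] [IsLocalRing R] (n : ℕ) :=
  (maximalIdeal R ^ n : Ideal R) ⧸
    (maximalIdeal R • ⊤ : Submodule R (maximalIdeal R ^ n : Ideal R))

/-- A surjective additive map between vector spaces of the same dimension, the source being
finite-dimensional, is injective if it is semilinear along an isomorphism of fields. -/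
theorem injective_of_surjective_of_finrank_eq_of_semilinear {K L V W : Type*} [Field K] [Field L]
    [AddCommGroup V] [AddCommGroup W] [Module K V] [Module L W] [FiniteDimensional K V]
    (σ : K ≃+* L) (φ : V →+ W) (hφ : ∀ (c : K) (v : V), φ (c • v) = σ c • φ v)
    (hsurj : Function.Surjective φ) (hdim : Module.finrank K V = Module.finrank L W) :
    Function.Injective φ := by
  let _ : Module K W := Module.compHom W (σ : K →+* L)
  let ψ : V →ₗ[K] W := { toFun := φ, map_add' := φ.map_add, map_smul' := hφ }
  have hψ : Function.Surjective ψ := hsurj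
  have : FiniteDimensional K W := Module.Finite.of_surjective ψ hψ
  have hrank : Module.rank K W = Module.rank L W :=
    rank_eq_of_equiv_equiv σ (AddEquiv.refl W) σ.bijective fun _ _ => rfl
  have hKW : Module.finrank K V = Module.finrank K W := by
    rw [hdim, Module.finrank, Module.finrank, hrank]
  exact (LinearMap.injective_iff_surjective_of_finrank_eq_finrank hKW (f := ψ)).mpr hψ

section Graded

variable {A B : Type*} [CommRing A] [CommRing B] [IsLocalRing A] [IsLocalRing B]

theorem comap_maximalIdeal_of_surjective (f : A →+* B) (hf : Function.Surjective f) :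
    maximalIdeal A = (maximalIdeal B).comap f :=
  (eq_maximalIdeal (Ideal.comap_isMaximal_of_surjective f hf)).symm

theorem map_maximalIdeal_pow_of_surjective (f : A →+* B) (hf : Function.Surjective f) (n : ℕ) :
    (maximalIdeal A ^ n).map f = maximalIdeal B ^ n := by
  rw [Ideal.map_pow, comap_maximalIdeal_of_surjective f hf, Ideal.map_comap_of_surjective f hf]

/-- The map `𝔪_Aⁿ → 𝔪_Bⁿ` induced by a surjection of local rings. -/
def maximalIdealPowMap (f : A →+* B) (hf : Function.Surjective f) (n : ℕ) :
    (maximalIdeal A ^ n : Ideal A) →ₛₗ[f] (maximalIdeal B ^ n : Ideal B) where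
  toFun x := ⟨f x, map_maximalIdeal_pow_of_surjective f hf n ▸ Ideal.mem_map_of_mem f x.2⟩
  map_add' _ _ := Subtype.ext (map_add f _ _)
  map_smul' _ _ := Subtype.ext (map_mul f _ _)

theorem mem_maximalIdeal_smul_top_iff (n : ℕ) (x : (maximalIdeal A ^ n : Ideal A)) :
    x ∈ (maximalIdeal A • ⊤ : Submodule A (maximalIdeal A ^ n : Ideal A)) ↔
      (x : A) ∈ maximalIdeal A ^ (n + 1) := by
  rw [Submodule.mem_smul_top_iff, smul_eq_mul, pow_succ']

/-- The map `𝔪_Aⁿ/𝔪_Aⁿ⁺¹ → 𝔪_Bⁿ/𝔪_Bⁿ⁺¹` induced by a surjection of local rings. -/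
def gradedPieceMap (f : A →+* B) (hf : Function.Surjective f) (n : ℕ) :
    GradedPiece A n →ₛₗ[f] GradedPiece B n :=
  Submodule.mapQ _ _ (maximalIdealPowMap f hf n) fun x hx => by
    rw [mem_maximalIdeal_smul_top_iff] at hx
    rw [Submodule.mem_comap, mem_maximalIdeal_smul_top_iff]
    exact map_maximalIdeal_pow_of_surjective f hf (n + 1) ▸ Ideal.mem_map_of_mem f hx

theorem gradedPieceMap_surjective (f : A →+* B) (hf : Function.Surjective f) (n : ℕ) :
    Function.Surjective (gradedPieceMap f hf n) := by
  intro y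
  obtain ⟨⟨y, hy⟩, rfl⟩ := Submodule.Quotient.mk_surjective _ y
  obtain ⟨x, hx, rfl⟩ := (Ideal.mem_map_iff_of_surjective f hf).mp
    (map_maximalIdeal_pow_of_surjective f hf n ▸ hy)
  exact ⟨Submodule.Quotient.mk ⟨x, hx⟩, rfl⟩

theorem gradedPieceMap_injective [IsNoetherianRing A] (f : A →+* B) (hf : Function.Surjective f)
    (n : ℕ) (hdim : Module.finrank (A ⧸ maximalIdeal A) (GradedPiece A n) =
      Module.finrank (B ⧸ maximalIdeal B) (GradedPiece B n)) :
    Function.Injective (gradedPieceMap f hf n) := by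
  let _ : Field (A ⧸ maximalIdeal A) := Ideal.Quotient.field _
  let _ : Field (B ⧸ maximalIdeal B) := Ideal.Quotient.field _
  have hcomap := comap_maximalIdeal_of_surjective f hf
  let σ : (A ⧸ maximalIdeal A) →+* (B ⧸ maximalIdeal B) :=
    Ideal.quotientMap _ f hcomap.le
  have hσ : Function.Bijective σ :=
    ⟨Ideal.quotientMap_injective' hcomap.ge, Ideal.quotientMap_surjective hf⟩
  have : Module.Finite (A ⧸ maximalIdeal A) (GradedPiece A n) :=
    Module.Finite.of_restrictScalars_finite A _ _
  refine injective_of_surjective_of_finrank_eq_of_semilinear (RingEquiv.ofBijective σ hσ)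
    (gradedPieceMap f hf n).toAddMonoidHom ?_ (gradedPieceMap_surjective f hf n) hdim
  intro c v
  obtain ⟨a, rfl⟩ := Ideal.Quotient.mk_surjective c
  exact (gradedPieceMap f hf n).map_smulₛₗ a v

end Graded

/-- Propositions A.4(2)/A.7(2) of the paper, for spectra of noetherian local rings: a
surjective homomorphism `f : A → B` of commutative noetherian local rings such that for
every `n ≥ 0` the graded pieces `𝔪_Aⁿ/𝔪_Aⁿ⁺¹` and `𝔪_Bⁿ/𝔪_Bⁿ⁺¹` have the same (finite)
dimension over the respective residue fields is injective, hence an isomorphism. -/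
theorem injective_of_surjective_of_graded_dim_eq
    {A B : Type*} [CommRing A] [CommRing B]
    [IsNoetherianRing A] [IsNoetherianRing B] [IsLocalRing A] [IsLocalRing B]
    (f : A →+* B) (hf : Function.Surjective f)
    (hdim : ∀ n : ℕ,
      Module.finrank (A ⧸ maximalIdeal A) (GradedPiece A n) =
      Module.finrank (B ⧸ maximalIdeal B) (GradedPiece B n)) :
    Function.Injective f := by
  have hker : ∀ n x, f x = 0 → x ∈ maximalIdeal A ^ n := by
    intro n x hx
    induction n with
    | zero => simp
    | succ n ih =>
      have hzero : gradedPieceMap f hf n (Submodule.Quotient.mk ⟨x, ih⟩) = 0 :=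
        (Submodule.Quotient.mk_eq_zero _).mpr <| by
          rw [mem_maximalIdeal_smul_top_iff]
          change f x ∈ _
          rw [hx]
          exact zero_mem _
      have hmk := (map_eq_zero_iff _ (gradedPieceMap_injective f hf n (hdim n))).mp hzero
      exact (mem_maximalIdeal_smul_top_iff n _).mp ((Submodule.Quotient.mk_eq_zero _).mp hmk)
  rw [injective_iff_map_eq_zero]
  intro x hx
  have hinf : x ∈ ⨅ n, maximalIdeal A ^ n := (Submodule.mem_iInf _).mpr fun n => hker n x hx
  rwa [Ideal.iInf_pow_eq_bot_of_isLocalRing _ Ideal.IsPrime.ne_top'] at hinf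
end
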